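/- Suppose the sequence of positive numbers γ_n is chosen with γ_n → 0 so that K is C^∞ on ℝ². Let Ω be an open neighborhood of the origin in ℝ², let g be a smooth Riemannian metric on Ω whose Gaussian curvature equals K on Ω, and let z ∈ C²(Ω) be a solution of Darboux's equation on Ω satisfying ∇z(0,0) = 0. Then there exists N such that for every n ≥ N it is NOT the case that simultaneously ∇₂₂z = 0 at every point of both vertical sides ±v_n of ∂Xⁿ and ∇₁₁z = 0 at every point of both horizontal sides ±h_n of ∂Xⁿ. -/

import Mathlib

open Real Set Filter Topology

noncomputable section

/-- Partial derivative of `f : ℝ × ℝ → ℝ` in coordinate direction `i`. -/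
def pd (i : Fin 2) (f : ℝ × ℝ → ℝ) (p : ℝ × ℝ) : ℝ :=
  fderiv ℝ f p (if i = 0 then (1, 0) else (0, 1))

/-- The metric components as a 2×2 symmetric matrix of functions. -/
def gmat (g11 g12 g22 : ℝ × ℝ → ℝ) (i j : Fin 2) : ℝ × ℝ → ℝ :=
  if i = 0 then (if j = 0 then g11 else g12) else (if j = 0 then g12 else g22)

/-- The determinant of the metric. -/
def gdet (g11 g12 g22 : ℝ × ℝ → ℝ) (p : ℝ × ℝ) : ℝ :=
  g11 p * g22 p - g12 p ^ 2

/-- Components of the inverse metric. -/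
def ginv (g11 g12 g22 : ℝ × ℝ → ℝ) (i j : Fin 2) (p : ℝ × ℝ) : ℝ :=
  (if i = 0 then (if j = 0 then g22 p else -g12 p)
   else (if j = 0 then -g12 p else g11 p)) / gdet g11 g12 g22 p

/-- Christoffel symbols Γˡ_{ij}. -/
def Chr (g11 g12 g22 : ℝ × ℝ → ℝ) (l i j : Fin 2) (p : ℝ × ℝ) : ℝ :=
  (1 / 2) * ∑ m : Fin 2, ginv g11 g12 g22 l m p *
    (pd i (gmat g11 g12 g22 j m) p + pd j (gmat g11 g12 g22 i m) p
      - pd m (gmat g11 g12 g22 i j) p)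

/-- Second covariant derivatives ∇_{ij} z. -/
def cov2 (g11 g12 g22 z : ℝ × ℝ → ℝ) (i j : Fin 2) (p : ℝ × ℝ) : ℝ :=
  pd i (pd j z) p - ∑ l : Fin 2, Chr g11 g12 g22 l i j p * pd l z p

/-- |∇_g z|². -/
def gradSq (g11 g12 g22 z : ℝ × ℝ → ℝ) (p : ℝ × ℝ) : ℝ :=
  ∑ i : Fin 2, ∑ j : Fin 2, ginv g11 g12 g22 i j p * pd i z p * pd j z p

/-- The Gaussian curvature of the metric g. -/
def GaussK (g11 g12 g22 : ℝ × ℝ → ℝ) (p : ℝ × ℝ) : ℝ :=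
  (1 / gdet g11 g12 g22 p) * ∑ i : Fin 2, gmat g11 g12 g22 0 i p *
    (pd 0 (Chr g11 g12 g22 i 1 1) p - pd 1 (Chr g11 g12 g22 i 0 1) p
      + ∑ j : Fin 2, (Chr g11 g12 g22 j 1 1 p * Chr g11 g12 g22 i j 0 p
          - Chr g11 g12 g22 j 0 1 p * Chr g11 g12 g22 i j 1 p))

/-- Darboux's equation at a point p. -/
def DarbouxEq (g11 g12 g22 z : ℝ × ℝ → ℝ) (p : ℝ × ℝ) : Prop :=
  cov2 g11 g12 g22 z 0 0 p * cov2 g11 g12 g22 z 1 1 p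
      - cov2 g11 g12 g22 z 0 1 p * cov2 g11 g12 g22 z 1 0 p
    = GaussK g11 g12 g22 p * gdet g11 g12 g22 p * (1 - gradSq g11 g12 g22 z p)

/-- A smooth Riemannian metric on Ω. -/
def IsMetricOn (g11 g12 g22 : ℝ × ℝ → ℝ) (Ω : Set (ℝ × ℝ)) : Prop :=
  ContDiffOn ℝ (⊤ : ℕ∞) g11 Ω ∧ ContDiffOn ℝ (⊤ : ℕ∞) g12 Ω ∧ ContDiffOn ℝ (⊤ : ℕ∞) g22 Ω ∧
  ∀ p ∈ Ω, 0 < g11 p ∧ 0 < gdet g11 g12 g22 p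

/-- The centers q_n = (1/n, 0). -/
def qpt (n : ℕ) : ℝ × ℝ := (1 / (n : ℝ), 0)

/-- Half-width of the square Xⁿ (whose width is 1/(2n(n+1))). -/
def halfw (n : ℕ) : ℝ := 1 / (4 * (n : ℝ) * ((n : ℝ) + 1))

/-- The open axis-parallel square Xⁿ centered at q_n of width 1/(2n(n+1)). -/
def sqX (n : ℕ) : Set (ℝ × ℝ) :=
  {p | |p.1 - 1 / (n : ℝ)| < halfw n ∧ |p.2| < halfw n}

/-- The square X = (-1,1) × (-1,1). -/
def Xset : Set (ℝ × ℝ) := Ioo (-1 : ℝ) 1 ×ˢ Ioo (-1 : ℝ) 1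

/-- φ is C^∞ on the closure of X, vanishes to infinite order on ∂X, and has a sign on X. -/
def PhiAdmissible (φ : ℝ × ℝ → ℝ) : Prop :=
  ContDiffOn ℝ (⊤ : ℕ∞) φ (closure Xset) ∧
  (∀ k : ℕ, ∀ p ∈ frontier Xset, iteratedFDerivWithin ℝ k φ (closure Xset) p = 0) ∧
  ((∀ p ∈ Xset, 0 < φ p) ∨ (∀ p ∈ Xset, φ p < 0))

/-- K is obtained from φ and the sequence γ by the construction of the paper. -/
def Kconstr (φ : ℝ × ℝ → ℝ) (γ : ℕ → ℝ) (K : ℝ × ℝ → ℝ) : Prop :=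
  (∀ n : ℕ, 1 ≤ n → ∀ q ∈ closure (sqX n),
      K q = γ n * φ ((4 * (n : ℝ) * ((n : ℝ) + 1)) • (q - qpt n))) ∧
  (∀ q : ℝ × ℝ, q ∉ ⋃ n ∈ {m : ℕ | 1 ≤ m}, sqX n → K q = 0)

/-- Right vertical side +v_n of ∂Xⁿ. -/
def vSideR (n : ℕ) : Set (ℝ × ℝ) :=
  {p | p.1 = 1 / (n : ℝ) + halfw n ∧ |p.2| ≤ halfw n}

/-- Left vertical side -v_n of ∂Xⁿ. -/
def vSideL (n : ℕ) : Set (ℝ × ℝ) :=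
  {p | p.1 = 1 / (n : ℝ) - halfw n ∧ |p.2| ≤ halfw n}

/-- Top horizontal side +h_n of ∂Xⁿ. -/
def hSideT (n : ℕ) : Set (ℝ × ℝ) :=
  {p | p.2 = halfw n ∧ |p.1 - 1 / (n : ℝ)| ≤ halfw n}

/-- Bottom horizontal side -h_n of ∂Xⁿ. -/
def hSideB (n : ℕ) : Set (ℝ × ℝ) :=
  {p | p.2 = -halfw n ∧ |p.1 - 1 / (n : ℝ)| ≤ halfw n}

/-- At the point p there is a C³ change of coordinates Φ(x,y) = (x - p¹, s(x,y)) on a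
neighborhood U ⊆ Ω of p, a C² function u and a positive continuous f on Φ(U), solving
∂_tt u + (K ∘ Φ⁻¹) ∂_ss u = (K ∘ Φ⁻¹) f on Φ(U). -/
def GoodChartAt (K : ℝ × ℝ → ℝ) (Ω : Set (ℝ × ℝ)) (p : ℝ × ℝ) : Prop :=
  ∃ (U : Set (ℝ × ℝ)) (s : ℝ × ℝ → ℝ) (Ψ : ℝ × ℝ → ℝ × ℝ) (u f : ℝ × ℝ → ℝ),
    IsOpen U ∧ p ∈ U ∧ U ⊆ Ω ∧ ContDiffOn ℝ 3 s U ∧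
    IsOpen ((fun q => (q.1 - p.1, s q)) '' U) ∧
    ContDiffOn ℝ 3 Ψ ((fun q => (q.1 - p.1, s q)) '' U) ∧
    (∀ q ∈ U, Ψ (q.1 - p.1, s q) = q) ∧
    (∀ w ∈ (fun q => (q.1 - p.1, s q)) '' U, ((Ψ w).1 - p.1, s (Ψ w)) = w) ∧
    ContDiffOn ℝ 2 u ((fun q => (q.1 - p.1, s q)) '' U) ∧
    ContinuousOn f ((fun q => (q.1 - p.1, s q)) '' U) ∧
    (∀ w ∈ (fun q => (q.1 - p.1, s q)) '' U, 0 < f w) ∧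
    (∀ w ∈ (fun q => (q.1 - p.1, s q)) '' U,
      pd 0 (pd 0 u) w + K (Ψ w) * pd 1 (pd 1 u) w = K (Ψ w) * f w)

open MeasureTheory in
/-- A compactly supported `C¹` function is approximated by smooth functions, uniformly together
with its derivative. -/
lemma exists_contDiff_fderiv_approx {b : ℝ × ℝ → ℝ} (hb : ContDiff ℝ 1 b)
    (hs : HasCompactSupport b) {ε : ℝ} (hε : 0 < ε) :
    ∃ G : ℝ × ℝ → ℝ, ContDiff ℝ 2 G ∧ ∀ x, ‖fderiv ℝ G x - fderiv ℝ b x‖ ≤ ε := by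
  have hc : Continuous (fderiv ℝ b) := hb.continuous_fderiv one_ne_zero
  have huc : UniformContinuous (fderiv ℝ b) := (hs.fderiv ℝ).uniformContinuous_of_continuous hc
  obtain ⟨δ, hδ, h⟩ := Metric.uniformContinuous_iff.1 huc ε hε
  let ρ : ContDiffBump (0 : ℝ × ℝ) := ⟨δ / 2, δ, by positivity, by linarith⟩
  refine ⟨convolution (ρ.normed volume) b (ContinuousLinearMap.lsmul ℝ ℝ) volume, ?_, fun x => ?_⟩
  · exact ρ.hasCompactSupport_normed.contDiff_convolution_left _ ρ.contDiff_normed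
      hb.continuous.locallyIntegrable
  · have hd := hs.hasFDerivAt_convolution_right (μ := volume) (ContinuousLinearMap.lsmul ℝ ℝ)
      (ρ.continuous_normed (μ := volume)).locallyIntegrable hb x
    rw [hd.fderiv, ← dist_eq_norm]
    have key := ρ.dist_normed_convolution_le (μ := volume) (g := fderiv ℝ b) (x₀ := x) (ε := ε)
      hc.aestronglyMeasurable (fun y hy => (h hy).le)
    convert key using 2
    simp only [convolution]
    congr 1

open MeasureTheory in
lemma tendsto_setIntegral_of_norm_sub_le {α : Type*} [TopologicalSpace α] [MeasurableSpace α]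
    [OpensMeasurableSpace α] [T2Space α] {μ : Measure α} [IsFiniteMeasureOnCompacts μ]
    {s : Set α} (hs : IsCompact s) {f : ℕ → α → ℝ} {F : α → ℝ} (hf : ∀ n, ContinuousOn (f n) s)
    (hF : ContinuousOn F s) {C : ℝ} (h : ∀ n, ∀ x ∈ s, ‖f n x - F x‖ ≤ C * (1 / ((n : ℝ) + 1))) :
    Tendsto (fun n => ∫ x in s, f n x ∂μ) atTop (𝓝 (∫ x in s, F x ∂μ)) := by
  rw [tendsto_iff_norm_sub_tendsto_zero]
  have hlim : Tendsto (fun n : ℕ => C * (1 / ((n : ℝ) + 1)) * μ.real s) atTop (𝓝 0) := by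
    simpa using (tendsto_one_div_add_atTop_nhds_zero_nat (𝕜 := ℝ)).const_mul C |>.mul_const
      (μ.real s)
  refine squeeze_zero (fun n => norm_nonneg _) (fun n => ?_) hlim
  rw [← integral_sub ((hf n).integrableOn_compact' hs hs.measurableSet)
    (hF.integrableOn_compact' hs hs.measurableSet)]
  exact norm_setIntegral_le_of_norm_le_const hs.measure_lt_top (h n)

lemma hasFDerivAt_apply_pd {f : ℝ × ℝ → ℝ} (v : ℝ × ℝ) (hf : ContDiff ℝ 2 f) (x : ℝ × ℝ) :
    HasFDerivAt (fun y => fderiv ℝ f y v)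
      ((fderiv ℝ (fderiv ℝ f) x).flip v) x := by
  have h1 : DifferentiableAt ℝ (fderiv ℝ f) x :=
    ((hf.fderiv_right (m := 1) (by norm_num)).differentiable one_ne_zero) x
  simpa using h1.hasFDerivAt.clm_apply (hasFDerivAt_const v x)

open MeasureTheory in
/-- Green's formula for the one-form `a db` on a rectangle. -/
lemma green_of_contDiff_two {a b : ℝ × ℝ → ℝ} (ha : ContDiff ℝ 1 a) (hb : ContDiff ℝ 2 b)
    {p q : ℝ × ℝ} (hpq : p ≤ q) :
    ∫ x in Icc p q, (fderiv ℝ a x (1, 0) * fderiv ℝ b x (0, 1)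
        - fderiv ℝ a x (0, 1) * fderiv ℝ b x (1, 0))
      = (∫ y in Icc p.2 q.2, a (q.1, y) * fderiv ℝ b (q.1, y) (0, 1))
        - (∫ y in Icc p.2 q.2, a (p.1, y) * fderiv ℝ b (p.1, y) (0, 1))
        - (∫ x in Icc p.1 q.1, a (x, q.2) * fderiv ℝ b (x, q.2) (1, 0))
        + (∫ x in Icc p.1 q.1, a (x, p.2) * fderiv ℝ b (x, p.2) (1, 0)) := by
  have hac := ha.continuous
  have ha' : Continuous (fderiv ℝ a) := ha.continuous_fderiv one_ne_zero
  have hb' : Continuous (fderiv ℝ b) := hb.continuous_fderiv two_ne_zero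
  have hda : ∀ x, HasFDerivAt a (fderiv ℝ a x) x := fun x =>
    (ha.differentiable one_ne_zero x).hasFDerivAt
  have hsymm : ∀ x, fderiv ℝ (fderiv ℝ b) x (1, 0) (0, 1) = fderiv ℝ (fderiv ℝ b) x (0, 1) (1, 0) :=
    fun x => (hb.contDiffAt.isSymmSndFDerivAt (by simp)).eq _ _
  have key : ∀ x, (a x • (fderiv ℝ (fderiv ℝ b) x).flip (0, 1)
        + (fderiv ℝ b x (0, 1)) • fderiv ℝ a x) (1, 0)
      + (-(a x • (fderiv ℝ (fderiv ℝ b) x).flip (1, 0)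
        + (fderiv ℝ b x (1, 0)) • fderiv ℝ a x)) (0, 1)
      = fderiv ℝ a x (1, 0) * fderiv ℝ b x (0, 1)
        - fderiv ℝ a x (0, 1) * fderiv ℝ b x (1, 0) := by
    intro x
    simp only [add_apply, neg_apply,
      smul_apply, ContinuousLinearMap.flip_apply, smul_eq_mul, hsymm x]
    ring
  have hdiv := integral_divergence_prod_Icc_of_hasFDerivAt_of_le
    (fun x => a x * fderiv ℝ b x (0, 1)) (fun x => -(a x * fderiv ℝ b x (1, 0)))
    _ _ p q hpq (by fun_prop) (by fun_prop)
    (fun x _ => (hda x).mul (hasFDerivAt_apply_pd (0, 1) hb x))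
    (fun x _ => ((hda x).mul (hasFDerivAt_apply_pd (1, 0) hb x)).neg)
    (by
      simp_rw [key]
      refine ContinuousOn.integrableOn_compact isCompact_Icc (Continuous.continuousOn ?_)
      fun_prop)
  simp_rw [key] at hdiv
  rw [hdiv, intervalIntegral.integral_of_le hpq.1, intervalIntegral.integral_of_le hpq.1,
    intervalIntegral.integral_of_le hpq.2, intervalIntegral.integral_of_le hpq.2,
    integral_Icc_eq_integral_Ioc, integral_Icc_eq_integral_Ioc, integral_Icc_eq_integral_Ioc,
    integral_Icc_eq_integral_Ioc, integral_neg, integral_neg]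
  ring

open MeasureTheory in
lemma green_of_hasCompactSupport {a b : ℝ × ℝ → ℝ} (ha : ContDiff ℝ 1 a) (hb : ContDiff ℝ 1 b)
    (hbs : HasCompactSupport b) {p q : ℝ × ℝ} (hpq : p ≤ q) :
    ∫ x in Icc p q, (fderiv ℝ a x (1, 0) * fderiv ℝ b x (0, 1)
        - fderiv ℝ a x (0, 1) * fderiv ℝ b x (1, 0))
      = (∫ y in Icc p.2 q.2, a (q.1, y) * fderiv ℝ b (q.1, y) (0, 1))
        - (∫ y in Icc p.2 q.2, a (p.1, y) * fderiv ℝ b (p.1, y) (0, 1))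
        - (∫ x in Icc p.1 q.1, a (x, q.2) * fderiv ℝ b (x, q.2) (1, 0))
        + (∫ x in Icc p.1 q.1, a (x, p.2) * fderiv ℝ b (x, p.2) (1, 0)) := by
  choose G hG hGb using fun n : ℕ =>
    exists_contDiff_fderiv_approx hb hbs (ε := 1 / ((n : ℝ) + 1)) (by positivity)
  have ha0 := ha.continuous
  have ha' : Continuous (fderiv ℝ a) := ha.continuous_fderiv one_ne_zero
  have hb' : Continuous (fderiv ℝ b) := hb.continuous_fderiv one_ne_zero
  have hG' : ∀ n, Continuous (fderiv ℝ (G n)) := fun n => (hG n).continuous_fderiv two_ne_zero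
  obtain ⟨M, hM⟩ := isCompact_Icc.exists_bound_of_continuousOn (s := Icc p q) ha0.continuousOn
  obtain ⟨M', hM'⟩ := isCompact_Icc.exists_bound_of_continuousOn (s := Icc p q) ha'.continuousOn
  have hv : ∀ n x, ‖fderiv ℝ (G n) x (0, 1) - fderiv ℝ b x (0, 1)‖ ≤ 1 / ((n : ℝ) + 1) :=
    fun n x => by
      simpa using ((fderiv ℝ (G n) x - fderiv ℝ b x).le_opNorm (0, 1)).trans
        (mul_le_mul_of_nonneg_right (hGb n x) (norm_nonneg _))
  have hh : ∀ n x, ‖fderiv ℝ (G n) x (1, 0) - fderiv ℝ b x (1, 0)‖ ≤ 1 / ((n : ℝ) + 1) :=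
    fun n x => by
      simpa using ((fderiv ℝ (G n) x - fderiv ℝ b x).le_opNorm (1, 0)).trans
        (mul_le_mul_of_nonneg_right (hGb n x) (norm_nonneg _))
  have mulb : ∀ {A u v C e : ℝ}, ‖A‖ ≤ C → ‖u - v‖ ≤ e → ‖A * u - A * v‖ ≤ C * e := by
    intro A u v C e h1 h2
    rw [← mul_sub, norm_mul]
    exact mul_le_mul h1 h2 (norm_nonneg _) ((norm_nonneg _).trans h1)
  have mulb' : ∀ x ∈ Icc p q, ‖fderiv ℝ a x (1, 0)‖ ≤ M' ∧ ‖fderiv ℝ a x (0, 1)‖ ≤ M' :=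
    fun x hx =>
    ⟨by
      simpa using ((fderiv ℝ a x).le_opNorm (1, 0)).trans
        (mul_le_mul_of_nonneg_right (hM' x hx) (norm_nonneg _)), by
       simpa using ((fderiv ℝ a x).le_opNorm (0, 1)).trans
        (mul_le_mul_of_nonneg_right (hM' x hx) (norm_nonneg _))⟩
  have L : Tendsto (fun n => ∫ x in Icc p q, (fderiv ℝ a x (1, 0) * fderiv ℝ (G n) x (0, 1)
        - fderiv ℝ a x (0, 1) * fderiv ℝ (G n) x (1, 0))) atTop (𝓝 (∫ x in Icc p q,
        (fderiv ℝ a x (1, 0) * fderiv ℝ b x (0, 1)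
        - fderiv ℝ a x (0, 1) * fderiv ℝ b x (1, 0)))) := by
    refine tendsto_setIntegral_of_norm_sub_le isCompact_Icc
      (fun n => Continuous.continuousOn (by have := hG' n; fun_prop))
      (Continuous.continuousOn (by fun_prop)) (C := M' + M') (fun n x hx => ?_)
    rw [sub_sub_sub_comm, add_mul]
    exact (norm_sub_le _ _).trans (add_le_add (mulb (mulb' x hx).1 (hv n x))
      (mulb (mulb' x hx).2 (hh n x)))
  have R1 : ∀ c ∈ Icc p.1 q.1, Tendsto
      (fun n => ∫ y in Icc p.2 q.2, a (c, y) * fderiv ℝ (G n) (c, y) (0, 1)) atTop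
      (𝓝 (∫ y in Icc p.2 q.2, a (c, y) * fderiv ℝ b (c, y) (0, 1))) := fun c hc =>
    tendsto_setIntegral_of_norm_sub_le isCompact_Icc
      (fun n => Continuous.continuousOn (by have := hG' n; fun_prop))
      (Continuous.continuousOn (by fun_prop)) (C := M)
      (fun n y hy => mulb (hM _ ⟨⟨hc.1, hy.1⟩, ⟨hc.2, hy.2⟩⟩) (hv n _))
  have R2 : ∀ c ∈ Icc p.2 q.2, Tendsto
      (fun n => ∫ x in Icc p.1 q.1, a (x, c) * fderiv ℝ (G n) (x, c) (1, 0)) atTop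
      (𝓝 (∫ x in Icc p.1 q.1, a (x, c) * fderiv ℝ b (x, c) (1, 0))) := fun c hc =>
    tendsto_setIntegral_of_norm_sub_le isCompact_Icc
      (fun n => Continuous.continuousOn (by have := hG' n; fun_prop))
      (Continuous.continuousOn (by fun_prop)) (C := M)
      (fun n y hy => mulb (hM _ ⟨⟨hy.1, hc.1⟩, ⟨hy.2, hc.2⟩⟩) (hh n _))
  refine tendsto_nhds_unique L ?_
  simp_rw [green_of_contDiff_two ha (hG _) hpq]
  exact (((R1 _ ⟨hpq.1, le_rfl⟩).sub (R1 _ ⟨le_rfl, hpq.1⟩)).sub (R2 _ ⟨hpq.2, le_rfl⟩)).add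
    (R2 _ ⟨le_rfl, hpq.2⟩)

/-- A `C¹` function near a closed ball agrees with a compactly supported `C¹` function on the
concentric ball of half the radius. -/
lemma exists_contDiff_hasCompactSupport_eqOn {Ω : Set (ℝ × ℝ)} (hΩ : IsOpen Ω)
    {f : ℝ × ℝ → ℝ} (hf : ContDiffOn ℝ 1 f Ω) {c : ℝ × ℝ} {R : ℝ} (hR : 0 < R)
    (hc : Metric.closedBall c R ⊆ Ω) :
    ∃ F : ℝ × ℝ → ℝ, ContDiff ℝ 1 F ∧ HasCompactSupport F ∧
      EqOn F f (Metric.ball c (R / 2)) := by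
  let ρ : ContDiffBump c := ⟨R / 2, R, by positivity, by linarith⟩
  refine ⟨fun x => ρ x * f x, ?_, ρ.hasCompactSupport.mul_right, fun x hx => ?_⟩
  · rw [contDiff_iff_contDiffAt]
    intro x
    by_cases hx : x ∈ Ω
    · exact ρ.contDiff.contDiffAt.mul (hf.contDiffAt (hΩ.mem_nhds hx))
    · have hx' : x ∈ (Metric.closedBall c R)ᶜ := fun h => hx (hc h)
      refine (contDiffAt_const (c := (0 : ℝ))).congr_of_eventuallyEq ?_
      filter_upwards [Metric.isClosed_closedBall.isOpen_compl.mem_nhds hx'] with y hy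
      have : ρ y = 0 := ρ.zero_of_le_dist (by
        simp only [mem_compl_iff, Metric.mem_closedBall, not_le] at hy; exact hy.le)
      simp [this]
  · have : ρ x = 1 := ρ.one_of_mem_closedBall (Metric.ball_subset_closedBall hx)
    simp [this]

lemma pd_congr_of_eqOn_isOpen {U : Set (ℝ × ℝ)} (hU : IsOpen U) {f g : ℝ × ℝ → ℝ}
    (h : EqOn f g U) (i : Fin 2) : EqOn (pd i f) (pd i g) U := fun x hx => by
  unfold pd
  rw [(h.eventuallyEq_of_mem (hU.mem_nhds hx)).fderiv_eq]

open MeasureTheory in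
/-- Green's formula for the one-form `a db`, with `a` and `b` of class `C¹` near a rectangle. -/
lemma green_contDiffOn {Ω : Set (ℝ × ℝ)} (hΩ : IsOpen Ω) {a b : ℝ × ℝ → ℝ}
    (ha : ContDiffOn ℝ 1 a Ω) (hb : ContDiffOn ℝ 1 b Ω) {c : ℝ × ℝ} {R : ℝ} (hR : 0 < R)
    (hc : Metric.closedBall c R ⊆ Ω) {p q : ℝ × ℝ} (hpq : p ≤ q)
    (hball : Icc p q ⊆ Metric.ball c (R / 2)) :
    ∫ x in Icc p q, (pd 0 a x * pd 1 b x - pd 1 a x * pd 0 b x)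
      = (∫ y in Icc p.2 q.2, a (q.1, y) * pd 1 b (q.1, y))
        - (∫ y in Icc p.2 q.2, a (p.1, y) * pd 1 b (p.1, y))
        - (∫ x in Icc p.1 q.1, a (x, q.2) * pd 0 b (x, q.2))
        + (∫ x in Icc p.1 q.1, a (x, p.2) * pd 0 b (x, p.2)) := by
  obtain ⟨A, hA, -, hAa⟩ := exists_contDiff_hasCompactSupport_eqOn hΩ ha hR hc
  obtain ⟨B, hB, hBs, hBb⟩ := exists_contDiff_hasCompactSupport_eqOn hΩ hb hR hc
  have hAd := fun i => pd_congr_of_eqOn_isOpen Metric.isOpen_ball hAa i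
  have hBd := fun i => pd_congr_of_eqOn_isOpen Metric.isOpen_ball hBb i
  have h := green_of_hasCompactSupport hA hB hBs hpq
  have e0 : ∀ (F : ℝ × ℝ → ℝ) (x : ℝ × ℝ), fderiv ℝ F x (1, 0) = pd 0 F x := fun F x => by
    simp [pd]
  have e1 : ∀ (F : ℝ × ℝ → ℝ) (x : ℝ × ℝ), fderiv ℝ F x (0, 1) = pd 1 F x := fun F x => by
    simp [pd]
  simp_rw [e0, e1] at h
  have v : ∀ c' ∈ Icc p.1 q.1, ∀ y ∈ Icc p.2 q.2, A (c', y) * pd 1 B (c', y)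
      = a (c', y) * pd 1 b (c', y) := fun c' hc' y hy => by
    have hm := hball (show (c', y) ∈ Icc p q from ⟨⟨hc'.1, hy.1⟩, ⟨hc'.2, hy.2⟩⟩)
    rw [hAa hm, hBd 1 hm]
  have u : ∀ c' ∈ Icc p.2 q.2, ∀ x ∈ Icc p.1 q.1, A (x, c') * pd 0 B (x, c')
      = a (x, c') * pd 0 b (x, c') := fun c' hc' y hy => by
    have hm := hball (show (y, c') ∈ Icc p q from ⟨⟨hy.1, hc'.1⟩, ⟨hy.2, hc'.2⟩⟩)
    rw [hAa hm, hBd 0 hm]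
  rw [setIntegral_congr_fun measurableSet_Icc (v _ ⟨hpq.1, le_rfl⟩),
    setIntegral_congr_fun measurableSet_Icc (v _ ⟨le_rfl, hpq.1⟩),
    setIntegral_congr_fun measurableSet_Icc (u _ ⟨hpq.2, le_rfl⟩),
    setIntegral_congr_fun measurableSet_Icc (u _ ⟨le_rfl, hpq.2⟩)] at h
  rw [← h]
  refine setIntegral_congr_fun measurableSet_Icc (fun x hx => ?_)
  simp only [hAd 0 (hball hx), hAd 1 (hball hx), hBd 0 (hball hx), hBd 1 (hball hx)]

/-- The pointwise algebraic identity expressing the divergence of `w (p dq - q dp)`-type flux in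
terms of the curvature. -/
lemma flux_identity {a b c D K S w p q px py qx qy P0 P1 Q0 Q1 R0 R1
    wx wy P0y P1y Q0x Q1x Q0y Q1y R0x R1x : ℝ}
    (hD : D = a * c - b ^ 2) (hD0 : D ≠ 0) (hwx : wx = -w * (P0 + Q1)) (hwy : wy = -w * (Q0 + R1))
    (hsym : qx = py)
    (h00 : a * (Q0x - P0y + Q0 * Q1 - R0 * P1) + b * (Q1x - P1y + P1 * Q0 + Q1 * Q1 - Q1 * P0 - R1 * P1) = 0)
    (h11 : b * (R0x - Q0y + P0 * R0 + Q0 * R1 - Q0 * Q0 - R0 * Q1) + c * (R1x - Q1y + P1 * R0 - Q1 * Q0) = 0)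
    (h01 : a * (R0x - Q0y + P0 * R0 + Q0 * R1 - Q0 * Q0 - R0 * Q1) + b * (R1x - Q1y + P1 * R0 - Q1 * Q0)
      + b * (Q0x - P0y + Q0 * Q1 - R0 * P1) + c * (Q1x - P1y + P1 * Q0 + Q1 * Q1 - Q1 * P0 - R1 * P1) = 0)
    (hK : a * (R0x - Q0y + P0 * R0 + Q0 * R1 - Q0 * Q0 - R0 * Q1) + b * (R1x - Q1y + P1 * R0 - Q1 * Q0)
      = K * D)
    (hS : D * S = c * p ^ 2 - 2 * b * p * q + a * q ^ 2)
    (hdar : (px - (P0 * p + P1 * q)) * (qy - (R0 * p + R1 * q))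
      - (qx - (Q0 * p + Q1 * q)) * (py - (Q0 * p + Q1 * q)) = K * D * (1 - S)) :
    wx * (p * qy - q * py) - wy * (p * qx - q * px) + 2 * w * (px * qy - py * qx)
      + (wx * (-p * (R0 * p + R1 * q) + q * (Q0 * p + Q1 * q))
        + w * (-px * (R0 * p + R1 * q) - p * (R0x * p + R0 * px + (R1x * q + R1 * qx))
          + qx * (Q0 * p + Q1 * q) + q * (Q0x * p + Q0 * px + (Q1x * q + Q1 * qx))))
      - (wy * (-p * (Q0 * p + Q1 * q) + q * (P0 * p + P1 * q))
        + w * (-py * (Q0 * p + Q1 * q) - p * (Q0y * p + Q0 * py + (Q1y * q + Q1 * qy))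
          + qy * (P0 * p + P1 * q) + q * (P0y * p + P0 * py + (P1y * q + P1 * qy))))
      = w * D * (K * (2 - 3 * S)) := by
  generalize e00 : Q0x - P0y + Q0 * Q1 - R0 * P1 = r00 at *
  generalize e10 : Q1x - P1y + P1 * Q0 + Q1 * Q1 - Q1 * P0 - R1 * P1 = r10 at *
  generalize e01 : R0x - Q0y + P0 * R0 + Q0 * R1 - Q0 * Q0 - R0 * Q1 = r01 at *
  generalize e11 : R1x - Q1y + P1 * R0 - Q1 * Q0 = r11 at *
  have k01 : r01 = c * K := mul_left_cancel₀ hD0 (by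
    linear_combination c * hK - b * h11 + r01 * hD)
  have k11 : r11 = -b * K := mul_left_cancel₀ hD0 (by
    linear_combination -b * hK + a * h11 + r11 * hD)
  have k00 : r00 = b * K := mul_left_cancel₀ hD0 (by
    linear_combination c * h00 - b * h01 + b * hK + r00 * hD)
  have k10 : r10 = -a * K := mul_left_cancel₀ hD0 (by
    linear_combination a * h01 - b * h00 - a * hK + r10 * hD)
  subst hwx hwy hsym
  have f01 : R0x = c * K + Q0y - P0 * R0 - Q0 * R1 + Q0 * Q0 + R0 * Q1 := by
    linear_combination e01 + k01
  have f11 : R1x = -b * K + Q1y - P1 * R0 + Q1 * Q0 := by linear_combination e11 + k11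
  have f00 : Q0x = b * K + P0y - Q0 * Q1 + R0 * P1 := by linear_combination e00 + k00
  have f10 : Q1x = -a * K + P1y - P1 * Q0 - Q1 * Q1 + Q1 * P0 + R1 * P1 := by
    linear_combination e10 + k10
  subst f01 f11 f00 f10
  linear_combination 2 * w * hdar + w * K * hS

section Calculus

variable {f g : ℝ × ℝ → ℝ} {x : ℝ × ℝ}

lemma pd_mul (i : Fin 2) (hf : DifferentiableAt ℝ f x) (hg : DifferentiableAt ℝ g x) :
    pd i (fun y => f y * g y) x = pd i f x * g x + f x * pd i g x := by
  simp only [pd, fderiv_fun_mul hf hg, add_apply, smul_apply, smul_eq_mul]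
  ring

lemma pd_add (i : Fin 2) (hf : DifferentiableAt ℝ f x) (hg : DifferentiableAt ℝ g x) :
    pd i (fun y => f y + g y) x = pd i f x + pd i g x := by
  simp only [pd, fderiv_fun_add hf hg, add_apply]

lemma pd_sub (i : Fin 2) (hf : DifferentiableAt ℝ f x) (hg : DifferentiableAt ℝ g x) :
    pd i (fun y => f y - g y) x = pd i f x - pd i g x := by
  simp only [pd, fderiv_fun_sub hf hg, sub_apply]

lemma pd_neg (i : Fin 2) : pd i (fun y => -f y) x = -pd i f x := by
  simp only [pd, fderiv_fun_neg, neg_apply]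

lemma pd_const (i : Fin 2) (r : ℝ) : pd i (fun _ => r) x = 0 := by
  simp [pd]

lemma pd_fst (i : Fin 2) : pd i Prod.fst x = if i = 0 then 1 else 0 := by
  rw [pd, fderiv_fst]; split_ifs <;> simp

lemma pd_snd (i : Fin 2) : pd i Prod.snd x = if i = 0 then 0 else 1 := by
  rw [pd, fderiv_snd]; split_ifs <;> simp

lemma contDiffOn_pd {Ω : Set (ℝ × ℝ)} (hΩ : IsOpen Ω) (i : Fin 2) {m n : WithTop ℕ∞}
    (hf : ContDiffOn ℝ n f Ω) (hmn : m + 1 ≤ n) : ContDiffOn ℝ m (pd i f) Ω :=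
  (hf.fderiv_of_isOpen hΩ hmn).clm_apply contDiffOn_const

lemma pd_comm {Ω : Set (ℝ × ℝ)} (hΩ : IsOpen Ω) (hf : ContDiffOn ℝ 2 f Ω) (hx : x ∈ Ω)
    (i j : Fin 2) : pd i (pd j f) x = pd j (pd i f) x := by
  have hfx : ContDiffAt ℝ 2 f x := hf.contDiffAt (hΩ.mem_nhds hx)
  have h1 : DifferentiableAt ℝ (fderiv ℝ f) x :=
    (hfx.fderiv_right (m := 1) (by norm_num)).differentiableAt one_ne_zero
  have e : ∀ v w : ℝ × ℝ, fderiv ℝ (fun y => fderiv ℝ f y v) x w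
      = fderiv ℝ (fderiv ℝ f) x w v := fun v w => by
    have := (h1.hasFDerivAt.clm_apply (hasFDerivAt_const v x)).fderiv
    rw [this]; simp
  unfold pd
  rw [e, e]
  exact (hfx.isSymmSndFDerivAt (by simp)).eq _ _

end Calculus

section Metric

variable {g11 g12 g22 : ℝ × ℝ → ℝ}

lemma Chr_comm (l i j : Fin 2) : Chr g11 g12 g22 l i j = Chr g11 g12 g22 l j i := by
  funext x
  have h : gmat g11 g12 g22 i j = gmat g11 g12 g22 j i := by
    fin_cases i <;> fin_cases j <;> rfl
  simp only [Chr, h, add_comm (pd i _ x)]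

/-- Metric compatibility of the Christoffel symbols. -/
lemma pd_gmat {x : ℝ × ℝ} (hx : gdet g11 g12 g22 x ≠ 0) (k i j : Fin 2) :
    pd k (gmat g11 g12 g22 i j) x = ∑ m : Fin 2,
      (gmat g11 g12 g22 i m x * Chr g11 g12 g22 m k j x
        + gmat g11 g12 g22 j m x * Chr g11 g12 g22 m k i x) := by
  fin_cases k <;> fin_cases i <;> fin_cases j <;>
  · simp [Chr, ginv, gmat, Fin.sum_univ_two]
    field_simp
    simp only [gdet]
    ring

variable {Ω : Set (ℝ × ℝ)}

lemma contDiffOn_gmat (hg : IsMetricOn g11 g12 g22 Ω) (i j : Fin 2) :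
    ContDiffOn ℝ (⊤ : ℕ∞) (gmat g11 g12 g22 i j) Ω := by
  obtain ⟨h1, h2, h3, -⟩ := hg
  fin_cases i <;> fin_cases j <;> simpa [gmat]

lemma contDiffOn_gdet (hg : IsMetricOn g11 g12 g22 Ω) :
    ContDiffOn ℝ (⊤ : ℕ∞) (gdet g11 g12 g22) Ω :=
  (hg.1.mul hg.2.2.1).sub (hg.2.1.pow 2)

lemma contDiffOn_ginv (hg : IsMetricOn g11 g12 g22 Ω) (i j : Fin 2) :
    ContDiffOn ℝ (⊤ : ℕ∞) (ginv g11 g12 g22 i j) Ω := by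
  have hd := contDiffOn_gdet hg
  have h0 : ∀ x ∈ Ω, gdet g11 g12 g22 x ≠ 0 := fun x hx => (hg.2.2.2 x hx).2.ne'
  have h12 := hg.2.1.neg
  fin_cases i <;> fin_cases j
  · exact hg.2.2.1.div hd h0
  · exact h12.div hd h0
  · exact h12.div hd h0
  · exact hg.1.div hd h0

lemma contDiffOn_Chr (hΩ : IsOpen Ω) (hg : IsMetricOn g11 g12 g22 Ω) (l i j : Fin 2) :
    ContDiffOn ℝ 1 (Chr g11 g12 g22 l i j) Ω := by
  have hp : ∀ k i j : Fin 2, ContDiffOn ℝ 1 (pd k (gmat g11 g12 g22 i j)) Ω := fun k i j =>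
    contDiffOn_pd hΩ k ((contDiffOn_gmat hg i j).of_le (m := 2) (WithTop.coe_le_coe.2 (le_top (a := (2 : ℕ∞)))))
      (by norm_num)
  have hi : ∀ i j : Fin 2, ContDiffOn ℝ 1 (ginv g11 g12 g22 i j) Ω := fun i j =>
    (contDiffOn_ginv hg i j).of_le (by exact_mod_cast le_top)
  unfold Chr
  exact contDiffOn_const.mul (ContDiffOn.sum fun m _ => (hi l m).mul
    (((hp i j m).add (hp j i m)).sub (hp m i j)))

end Metric

section Curvature

variable {g11 g12 g22 : ℝ × ℝ → ℝ} {Ω : Set (ℝ × ℝ)}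

lemma pd_pd_gmat (hΩ : IsOpen Ω) (hg : IsMetricOn g11 g12 g22 Ω) {x : ℝ × ℝ} (hx : x ∈ Ω)
    (k k' i j : Fin 2) :
    pd k (pd k' (gmat g11 g12 g22 i j)) x = ∑ m : Fin 2,
      ((pd k (gmat g11 g12 g22 i m) x * Chr g11 g12 g22 m k' j x
          + gmat g11 g12 g22 i m x * pd k (Chr g11 g12 g22 m k' j) x)
        + (pd k (gmat g11 g12 g22 j m) x * Chr g11 g12 g22 m k' i x
          + gmat g11 g12 g22 j m x * pd k (Chr g11 g12 g22 m k' i) x)) := by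
  have hE : EqOn (pd k' (gmat g11 g12 g22 i j)) (fun y => ∑ m : Fin 2,
      (gmat g11 g12 g22 i m y * Chr g11 g12 g22 m k' j y
        + gmat g11 g12 g22 j m y * Chr g11 g12 g22 m k' i y)) Ω := fun y hy =>
    pd_gmat (hg.2.2.2 y hy).2.ne' k' i j
  have hG : ∀ i j, DifferentiableAt ℝ (gmat g11 g12 g22 i j) x := fun i j =>
    ((contDiffOn_gmat hg i j).contDiffAt (hΩ.mem_nhds hx)).differentiableAt (by simp)
  have hC : ∀ l i j, DifferentiableAt ℝ (Chr g11 g12 g22 l i j) x := fun l i j =>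
    ((contDiffOn_Chr hΩ hg l i j).contDiffAt (hΩ.mem_nhds hx)).differentiableAt one_ne_zero
  rw [pd_congr_of_eqOn_isOpen hΩ hE k hx]
  simp only [Fin.sum_univ_two]
  rw [pd_add _ (by fun_prop) (by fun_prop), pd_add _ (by fun_prop) (by fun_prop),
    pd_add _ (by fun_prop) (by fun_prop), pd_mul _ (by fun_prop) (by fun_prop),
    pd_mul _ (by fun_prop) (by fun_prop), pd_mul _ (by fun_prop) (by fun_prop),
    pd_mul _ (by fun_prop) (by fun_prop)]

/-- The curvature combinations appearing in the commutator of covariant derivatives `∇₁`, `∇₂`. -/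
def riem (g11 g12 g22 : ℝ × ℝ → ℝ) (l j : Fin 2) (x : ℝ × ℝ) : ℝ :=
  pd 0 (Chr g11 g12 g22 l 1 j) x - pd 1 (Chr g11 g12 g22 l 0 j) x
    + ∑ m : Fin 2, (Chr g11 g12 g22 l 0 m x * Chr g11 g12 g22 m 1 j x
      - Chr g11 g12 g22 l 1 m x * Chr g11 g12 g22 m 0 j x)

lemma riem_antisymm (hΩ : IsOpen Ω) (hg : IsMetricOn g11 g12 g22 Ω) {x : ℝ × ℝ} (hx : x ∈ Ω)
    (i j : Fin 2) :
    ∑ m : Fin 2, (gmat g11 g12 g22 i m x * riem g11 g12 g22 m j x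
      + gmat g11 g12 g22 j m x * riem g11 g12 g22 m i x) = 0 := by
  have hx0 := (hg.2.2.2 x hx).2.ne'
  have h := pd_comm hΩ ((contDiffOn_gmat hg i j).of_le (m := 2)
    (WithTop.coe_le_coe.2 (le_top (a := (2 : ℕ∞))))) hx 0 1
  rw [pd_pd_gmat hΩ hg hx, pd_pd_gmat hΩ hg hx] at h
  simp only [pd_gmat hx0, Fin.sum_univ_two, riem] at h ⊢
  have e : gmat g11 g12 g22 1 0 x = gmat g11 g12 g22 0 1 x := rfl
  fin_cases i <;> fin_cases j <;>
  · simp only [e, Fin.zero_eta, Fin.mk_one, Chr_comm _ 1 0] at h ⊢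
    linear_combination h

lemma gdet_mul_GaussK {x : ℝ × ℝ} (hx : gdet g11 g12 g22 x ≠ 0) :
    ∑ m : Fin 2, gmat g11 g12 g22 0 m x * riem g11 g12 g22 m 1 x
      = GaussK g11 g12 g22 x * gdet g11 g12 g22 x := by
  have : GaussK g11 g12 g22 x * gdet g11 g12 g22 x
      = ∑ i : Fin 2, gmat g11 g12 g22 0 i x *
    (pd 0 (Chr g11 g12 g22 i 1 1) x - pd 1 (Chr g11 g12 g22 i 0 1) x
      + ∑ j : Fin 2, (Chr g11 g12 g22 j 1 1 x * Chr g11 g12 g22 i j 0 x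
          - Chr g11 g12 g22 j 0 1 x * Chr g11 g12 g22 i j 1 x)) := by
    rw [GaussK]; field_simp
  rw [this]
  simp only [riem, Fin.sum_univ_two, Chr_comm _ 1 0]
  ring

/-- The inverse Riemannian area density. -/
def dens (g11 g12 g22 : ℝ × ℝ → ℝ) (x : ℝ × ℝ) : ℝ := (√(gdet g11 g12 g22 x))⁻¹

lemma contDiffOn_dens (hg : IsMetricOn g11 g12 g22 Ω) :
    ContDiffOn ℝ 1 (dens g11 g12 g22) Ω := by
  have h : ContDiffOn ℝ 1 (gdet g11 g12 g22) Ω :=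
    (contDiffOn_gdet hg).of_le (by exact_mod_cast le_top)
  exact (h.sqrt fun x hx => (hg.2.2.2 x hx).2.ne').inv
    fun x hx => (Real.sqrt_pos.2 (hg.2.2.2 x hx).2).ne'

lemma pd_dens (hΩ : IsOpen Ω) (hg : IsMetricOn g11 g12 g22 Ω) {x : ℝ × ℝ} (hx : x ∈ Ω)
    (k : Fin 2) :
    pd k (dens g11 g12 g22) x
      = -dens g11 g12 g22 x * (Chr g11 g12 g22 0 k 0 x + Chr g11 g12 g22 1 k 1 x) := by
  have hx0 := (hg.2.2.2 x hx).2
  have hG : ∀ i j, DifferentiableAt ℝ (gmat g11 g12 g22 i j) x := fun i j =>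
    ((contDiffOn_gmat hg i j).contDiffAt (hΩ.mem_nhds hx)).differentiableAt (by simp)
  have hw : DifferentiableAt ℝ (dens g11 g12 g22) x :=
    ((contDiffOn_dens hg).contDiffAt (hΩ.mem_nhds hx)).differentiableAt one_ne_zero
  have hd : DifferentiableAt ℝ (gdet g11 g12 g22) x :=
    ((contDiffOn_gdet hg).contDiffAt (hΩ.mem_nhds hx)).differentiableAt (by simp)
  have hD : pd k (gdet g11 g12 g22) x = 2 * gdet g11 g12 g22 x
      * (Chr g11 g12 g22 0 k 0 x + Chr g11 g12 g22 1 k 1 x) := by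
    have e : gdet g11 g12 g22 = fun y => gmat g11 g12 g22 0 0 y * gmat g11 g12 g22 1 1 y
        - gmat g11 g12 g22 0 1 y * gmat g11 g12 g22 0 1 y := by
      funext y; simp [gdet, gmat, sq]
    rw [e, pd_sub _ (by fun_prop) (by fun_prop), pd_mul _ (by fun_prop) (by fun_prop),
      pd_mul _ (by fun_prop) (by fun_prop)]
    simp only [pd_gmat hx0.ne', Fin.sum_univ_two,
      show gmat g11 g12 g22 1 0 x = gmat g11 g12 g22 0 1 x from rfl]
    ring
  have hE : EqOn (fun y => dens g11 g12 g22 y * dens g11 g12 g22 y * gdet g11 g12 g22 y)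
      (fun _ => 1) Ω := fun y hy => by
    have h1 := (hg.2.2.2 y hy).2
    have h2 := Real.sq_sqrt h1.le
    have h3 := (Real.sqrt_pos.2 h1).ne'
    simp only [dens]
    field_simp
    exact h2.symm
  have h := pd_congr_of_eqOn_isOpen hΩ hE k hx
  rw [pd_mul _ (by fun_prop) hd, pd_mul _ hw hw, pd_const, hD] at h
  have hw0 : dens g11 g12 g22 x ≠ 0 := inv_ne_zero (Real.sqrt_pos.2 hx0).ne'
  have h2 : (2 * dens g11 g12 g22 x * gdet g11 g12 g22 x) * (pd k (dens g11 g12 g22) x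
    + dens g11 g12 g22 x * (Chr g11 g12 g22 0 k 0 x + Chr g11 g12 g22 1 k 1 x)) = 0 := by
    linear_combination h
  have h3 := (mul_eq_zero.1 h2).resolve_left (by have := hx0.ne'; positivity)
  linear_combination h3

/-- The lower-order coefficients of the flux one-form of `z`. -/
def fluxCoeff (g11 g12 g22 z : ℝ × ℝ → ℝ) (i : Fin 2) (x : ℝ × ℝ) : ℝ :=
  dens g11 g12 g22 x *
    (-(pd 0 z x) * (Chr g11 g12 g22 0 i 1 x * pd 0 z x + Chr g11 g12 g22 1 i 1 x * pd 1 z x)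
      + pd 1 z x * (Chr g11 g12 g22 0 i 0 x * pd 0 z x + Chr g11 g12 g22 1 i 0 x * pd 1 z x))

lemma contDiffOn_fluxCoeff (hΩ : IsOpen Ω) (hg : IsMetricOn g11 g12 g22 Ω) {z : ℝ × ℝ → ℝ}
    (hz : ContDiffOn ℝ 2 z Ω) (i : Fin 2) :
    ContDiffOn ℝ 1 (fluxCoeff g11 g12 g22 z i) Ω := by
  have hp : ∀ i, ContDiffOn ℝ 1 (pd i z) Ω := fun i => contDiffOn_pd hΩ i hz (by norm_num)
  have hC := contDiffOn_Chr hΩ hg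
  have hw := contDiffOn_dens hg
  exact hw.mul (((hp 0).neg.mul (((hC _ _ _).mul (hp _)).add ((hC _ _ _).mul (hp _)))).add
    ((hp 1).mul (((hC _ _ _).mul (hp _)).add ((hC _ _ _).mul (hp _)))))

lemma pd_fluxCoeff (hΩ : IsOpen Ω) (hg : IsMetricOn g11 g12 g22 Ω) {z : ℝ × ℝ → ℝ}
    (hz : ContDiffOn ℝ 2 z Ω) {x : ℝ × ℝ} (hx : x ∈ Ω) (k i : Fin 2) :
    pd k (fluxCoeff g11 g12 g22 z i) x =
      pd k (dens g11 g12 g22) x *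
        (-(pd 0 z x) * (Chr g11 g12 g22 0 i 1 x * pd 0 z x + Chr g11 g12 g22 1 i 1 x * pd 1 z x)
          + pd 1 z x * (Chr g11 g12 g22 0 i 0 x * pd 0 z x + Chr g11 g12 g22 1 i 0 x * pd 1 z x))
      + dens g11 g12 g22 x *
        (-(pd k (pd 0 z) x)
            * (Chr g11 g12 g22 0 i 1 x * pd 0 z x + Chr g11 g12 g22 1 i 1 x * pd 1 z x)
          + -(pd 0 z x)
            * (pd k (Chr g11 g12 g22 0 i 1) x * pd 0 z x + Chr g11 g12 g22 0 i 1 x * pd k (pd 0 z) x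
              + (pd k (Chr g11 g12 g22 1 i 1) x * pd 1 z x
                + Chr g11 g12 g22 1 i 1 x * pd k (pd 1 z) x))
          + (pd k (pd 1 z) x
            * (Chr g11 g12 g22 0 i 0 x * pd 0 z x + Chr g11 g12 g22 1 i 0 x * pd 1 z x)
          + pd 1 z x
            * (pd k (Chr g11 g12 g22 0 i 0) x * pd 0 z x + Chr g11 g12 g22 0 i 0 x * pd k (pd 0 z) x
              + (pd k (Chr g11 g12 g22 1 i 0) x * pd 1 z x
                + Chr g11 g12 g22 1 i 0 x * pd k (pd 1 z) x)))) := by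
  have hp : ∀ i, DifferentiableAt ℝ (pd i z) x := fun i =>
    ((contDiffOn_pd (m := 1) hΩ i hz (by norm_num)).contDiffAt
      (hΩ.mem_nhds hx)).differentiableAt one_ne_zero
  have hC : ∀ l i j, DifferentiableAt ℝ (Chr g11 g12 g22 l i j) x := fun l i j =>
    ((contDiffOn_Chr hΩ hg l i j).contDiffAt (hΩ.mem_nhds hx)).differentiableAt one_ne_zero
  have hw : DifferentiableAt ℝ (dens g11 g12 g22) x :=
    ((contDiffOn_dens hg).contDiffAt (hΩ.mem_nhds hx)).differentiableAt one_ne_zero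
  unfold fluxCoeff
  rw [pd_mul _ hw (by fun_prop), pd_add _ (by fun_prop) (by fun_prop),
    pd_mul _ (by fun_prop) (by fun_prop), pd_mul _ (by fun_prop) (by fun_prop),
    pd_add _ (by fun_prop) (by fun_prop), pd_add _ (by fun_prop) (by fun_prop),
    pd_mul _ (by fun_prop) (by fun_prop), pd_mul _ (by fun_prop) (by fun_prop),
    pd_mul _ (by fun_prop) (by fun_prop), pd_mul _ (by fun_prop) (by fun_prop), pd_neg]

/-- For a solution of Darboux's equation, the exterior derivative of the flux one-form is a
multiple of the curvature. -/
lemma flux_divergence (hΩ : IsOpen Ω) (hg : IsMetricOn g11 g12 g22 Ω) {z : ℝ × ℝ → ℝ}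
    (hz : ContDiffOn ℝ 2 z Ω) {x : ℝ × ℝ} (hx : x ∈ Ω) (hD : DarbouxEq g11 g12 g22 z x) :
    (pd 0 (fun y => dens g11 g12 g22 y * pd 0 z y) x * pd 1 (pd 1 z) x
        - pd 1 (fun y => dens g11 g12 g22 y * pd 0 z y) x * pd 0 (pd 1 z) x)
      - (pd 0 (fun y => dens g11 g12 g22 y * pd 1 z y) x * pd 1 (pd 0 z) x
        - pd 1 (fun y => dens g11 g12 g22 y * pd 1 z y) x * pd 0 (pd 0 z) x)
      + (pd 0 (fluxCoeff g11 g12 g22 z 0) x * pd 1 Prod.fst x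
        - pd 1 (fluxCoeff g11 g12 g22 z 0) x * pd 0 Prod.fst x)
      + (pd 0 (fluxCoeff g11 g12 g22 z 1) x * pd 1 Prod.snd x
        - pd 1 (fluxCoeff g11 g12 g22 z 1) x * pd 0 Prod.snd x)
      = dens g11 g12 g22 x * gdet g11 g12 g22 x
        * (GaussK g11 g12 g22 x * (2 - 3 * gradSq g11 g12 g22 z x)) := by
  have hx0 := (hg.2.2.2 x hx).2.ne'
  have hp : ∀ i, DifferentiableAt ℝ (pd i z) x := fun i =>
    ((contDiffOn_pd (m := 1) hΩ i hz (by norm_num)).contDiffAt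
      (hΩ.mem_nhds hx)).differentiableAt one_ne_zero
  have hw : DifferentiableAt ℝ (dens g11 g12 g22) x :=
    ((contDiffOn_dens hg).contDiffAt (hΩ.mem_nhds hx)).differentiableAt one_ne_zero
  have h00 := riem_antisymm hΩ hg hx 0 0
  have h11 := riem_antisymm hΩ hg hx 1 1
  have h01 := riem_antisymm hΩ hg hx 0 1
  have hK := gdet_mul_GaussK hx0
  have hw0 := pd_dens hΩ hg hx 0
  have hw1 := pd_dens hΩ hg hx 1
  have hsym := pd_comm hΩ hz hx 0 1
  have e : gmat g11 g12 g22 1 0 x = gmat g11 g12 g22 0 1 x := rfl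
  have hdet : gdet g11 g12 g22 x = gmat g11 g12 g22 0 0 x * gmat g11 g12 g22 1 1 x
      - gmat g11 g12 g22 0 1 x ^ 2 := by simp [gdet, gmat]
  have hS : gdet g11 g12 g22 x * gradSq g11 g12 g22 z x
      = gmat g11 g12 g22 1 1 x * pd 0 z x ^ 2 - 2 * gmat g11 g12 g22 0 1 x * pd 0 z x * pd 1 z x
        + gmat g11 g12 g22 0 0 x * pd 1 z x ^ 2 := by
    simp [gradSq, ginv, gmat, Fin.sum_univ_two]
    field_simp
    ring
  simp only [riem, Fin.sum_univ_two, e, Chr_comm _ 1 0] at h00 h11 h01 hK hw0 hw1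
  simp only [DarbouxEq, cov2, Fin.sum_univ_two, Chr_comm _ 1 0] at hD
  rw [pd_fluxCoeff hΩ hg hz hx, pd_fluxCoeff hΩ hg hz hx, pd_fluxCoeff hΩ hg hz hx,
    pd_fluxCoeff hΩ hg hz hx, pd_mul _ hw (hp 0), pd_mul _ hw (hp 0), pd_mul _ hw (hp 1),
    pd_mul _ hw (hp 1)]
  simp only [pd_fst, pd_snd, Chr_comm _ 1 0]
  have := flux_identity
    (P0y := pd 1 (Chr g11 g12 g22 0 0 0) x) (P1y := pd 1 (Chr g11 g12 g22 1 0 0) x)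
    (Q0x := pd 0 (Chr g11 g12 g22 0 0 1) x) (Q1x := pd 0 (Chr g11 g12 g22 1 0 1) x)
    (Q0y := pd 1 (Chr g11 g12 g22 0 0 1) x) (Q1y := pd 1 (Chr g11 g12 g22 1 0 1) x)
    (R0x := pd 0 (Chr g11 g12 g22 0 1 1) x) (R1x := pd 0 (Chr g11 g12 g22 1 1 1) x) hdet hx0 hw0 hw1 hsym (by linear_combination h00 / 2)
    (by linear_combination h11 / 2) (by linear_combination h01) (by linear_combination hK)
    hS hD
  simp only [one_ne_zero, if_false, if_true]
  linear_combination this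

end Curvature

section Assembly

open MeasureTheory

lemma setIntegral_sub_add_add {α : Type*} [TopologicalSpace α] [MeasurableSpace α]
    [OpensMeasurableSpace α] [T2Space α] {μ : Measure α} [IsFiniteMeasureOnCompacts μ]
    {s : Set α} (hs : IsCompact s) {f₁ f₂ f₃ f₄ : α → ℝ} (h₁ : ContinuousOn f₁ s)
    (h₂ : ContinuousOn f₂ s) (h₃ : ContinuousOn f₃ s) (h₄ : ContinuousOn f₄ s) :
    ∫ x in s, (f₁ x - f₂ x + f₃ x + f₄ x) ∂μ
      = ∫ x in s, f₁ x ∂μ - ∫ x in s, f₂ x ∂μ + ∫ x in s, f₃ x ∂μ + ∫ x in s, f₄ x ∂μ := by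
  have i : ∀ {f : α → ℝ}, ContinuousOn f s → IntegrableOn f s μ := fun h =>
    h.integrableOn_compact' hs hs.measurableSet
  have i₁₂ : IntegrableOn (fun x => f₁ x - f₂ x) s μ := i (h₁.sub h₂)
  have i₁₂₃ : IntegrableOn (fun x => f₁ x - f₂ x + f₃ x) s μ := i ((h₁.sub h₂).add h₃)
  rw [integral_add i₁₂₃ (i h₄), integral_add i₁₂ (i h₃), integral_sub (i h₁) (i h₂)]

variable {g11 g12 g22 z : ℝ × ℝ → ℝ} {Ω : Set (ℝ × ℝ)}

/-- The total curvature integral of a solution of Darboux's equation vanishes over a rectangle on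
whose boundary the normal flux vanishes. -/
lemma setIntegral_curvature_eq_zero (hΩ : IsOpen Ω) (hg : IsMetricOn g11 g12 g22 Ω)
    (hz : ContDiffOn ℝ 2 z Ω) (hD : ∀ x ∈ Ω, DarbouxEq g11 g12 g22 z x) {c : ℝ × ℝ} {R : ℝ}
    (hR : 0 < R) (hc : Metric.closedBall c R ⊆ Ω) {p q : ℝ × ℝ} (hpq : p ≤ q)
    (hball : Icc p q ⊆ Metric.ball c (R / 2))
    (hv : ∀ s, s = p.1 ∨ s = q.1 → ∀ y ∈ Icc p.2 q.2,
      cov2 g11 g12 g22 z 1 1 (s, y) = 0 ∧ cov2 g11 g12 g22 z 1 0 (s, y) = 0)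
    (hh : ∀ s, s = p.2 ∨ s = q.2 → ∀ x ∈ Icc p.1 q.1,
      cov2 g11 g12 g22 z 0 0 (x, s) = 0 ∧ cov2 g11 g12 g22 z 0 1 (x, s) = 0) :
    ∫ x in Icc p q, dens g11 g12 g22 x * gdet g11 g12 g22 x
        * (GaussK g11 g12 g22 x * (2 - 3 * gradSq g11 g12 g22 z x)) = 0 := by
  have hsub : Icc p q ⊆ Ω := hball.trans
    ((Metric.ball_subset_closedBall.trans (Metric.closedBall_subset_closedBall (by linarith))).trans
      hc)
  have hp : ∀ i, ContDiffOn ℝ 1 (pd i z) Ω := fun i => contDiffOn_pd hΩ i hz (by norm_num)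
  have hw := contDiffOn_dens hg
  have hA := contDiffOn_fluxCoeff hΩ hg hz
  have hfst : ContDiffOn ℝ 1 (Prod.fst : ℝ × ℝ → ℝ) Ω := contDiff_fst.contDiffOn
  have hsnd : ContDiffOn ℝ 1 (Prod.snd : ℝ × ℝ → ℝ) Ω := contDiff_snd.contDiffOn
  have g1 := green_contDiffOn hΩ (hw.mul (hp 0)) (hp 1) hR hc hpq hball
  have g2 := green_contDiffOn hΩ (hw.mul (hp 1)) (hp 0) hR hc hpq hball
  have g3 := green_contDiffOn hΩ (hA 0) hfst hR hc hpq hball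
  have g4 := green_contDiffOn hΩ (hA 1) hsnd hR hc hpq hball
  have cpd : ∀ {f : ℝ × ℝ → ℝ}, ContDiffOn ℝ 1 f Ω → ∀ i, ContinuousOn (pd i f) Ω := fun hf i =>
    (contDiffOn_pd (m := 0) hΩ i hf (by norm_num)).continuousOn
  have cI : ∀ {a b : ℝ × ℝ → ℝ}, ContDiffOn ℝ 1 a Ω → ContDiffOn ℝ 1 b Ω →
      ContinuousOn (fun x => pd 0 a x * pd 1 b x - pd 1 a x * pd 0 b x) (Icc p q) := fun ha hb =>
    (((cpd ha 0).mul (cpd hb 1)).sub ((cpd ha 1).mul (cpd hb 0))).mono hsub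
  have cV : ∀ {a b : ℝ × ℝ → ℝ}, ContDiffOn ℝ 1 a Ω → ContDiffOn ℝ 1 b Ω → ∀ s ∈ Icc p.1 q.1,
      ContinuousOn (fun y => a (s, y) * pd 1 b (s, y)) (Icc p.2 q.2) := fun ha hb s hs =>
    (ha.continuousOn.mul (cpd hb 1)).comp (Continuous.continuousOn (by fun_prop))
      fun y hy => hsub ⟨⟨hs.1, hy.1⟩, ⟨hs.2, hy.2⟩⟩
  have cH : ∀ {a b : ℝ × ℝ → ℝ}, ContDiffOn ℝ 1 a Ω → ContDiffOn ℝ 1 b Ω → ∀ s ∈ Icc p.2 q.2,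
      ContinuousOn (fun x => a (x, s) * pd 0 b (x, s)) (Icc p.1 q.1) := fun ha hb s hs =>
    (ha.continuousOn.mul (cpd hb 0)).comp (Continuous.continuousOn (by fun_prop))
      fun y hy => hsub ⟨⟨hy.1, hs.1⟩, ⟨hy.2, hs.2⟩⟩
  have V : ∀ s, s = p.1 ∨ s = q.1 →
      (∫ y in Icc p.2 q.2, (dens g11 g12 g22 (s, y) * pd 0 z (s, y)) * pd 1 (pd 1 z) (s, y))
      - (∫ y in Icc p.2 q.2, (dens g11 g12 g22 (s, y) * pd 1 z (s, y)) * pd 1 (pd 0 z) (s, y))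
      + (∫ y in Icc p.2 q.2, fluxCoeff g11 g12 g22 z 0 (s, y) * pd 1 Prod.fst (s, y))
      + (∫ y in Icc p.2 q.2, fluxCoeff g11 g12 g22 z 1 (s, y) * pd 1 Prod.snd (s, y)) = 0 := by
    intro s hs
    have hs' : s ∈ Icc p.1 q.1 := by
      rcases hs with rfl | rfl
      exacts [⟨le_rfl, hpq.1⟩, ⟨hpq.1, le_rfl⟩]
    rw [← setIntegral_sub_add_add isCompact_Icc (cV (hw.mul (hp 0)) (hp 1) s hs')
      (cV (hw.mul (hp 1)) (hp 0) s hs') (cV (hA 0) hfst s hs') (cV (hA 1) hsnd s hs')]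
    refine setIntegral_eq_zero_of_forall_eq_zero fun y hy => ?_
    obtain ⟨e1, e2⟩ := hv s hs y hy
    simp only [cov2, Fin.sum_univ_two] at e1 e2
    simp only [pd_fst, pd_snd, fluxCoeff, one_ne_zero, if_false]
    linear_combination dens g11 g12 g22 (s, y) * (pd 0 z (s, y) * e1 - pd 1 z (s, y) * e2)
  have H : ∀ s, s = p.2 ∨ s = q.2 →
      (∫ x in Icc p.1 q.1, (dens g11 g12 g22 (x, s) * pd 0 z (x, s)) * pd 0 (pd 1 z) (x, s))
      - (∫ x in Icc p.1 q.1, (dens g11 g12 g22 (x, s) * pd 1 z (x, s)) * pd 0 (pd 0 z) (x, s))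
      + (∫ x in Icc p.1 q.1, fluxCoeff g11 g12 g22 z 0 (x, s) * pd 0 Prod.fst (x, s))
      + (∫ x in Icc p.1 q.1, fluxCoeff g11 g12 g22 z 1 (x, s) * pd 0 Prod.snd (x, s)) = 0 := by
    intro s hs
    have hs' : s ∈ Icc p.2 q.2 := by
      rcases hs with rfl | rfl
      exacts [⟨le_rfl, hpq.2⟩, ⟨hpq.2, le_rfl⟩]
    rw [← setIntegral_sub_add_add isCompact_Icc (cH (hw.mul (hp 0)) (hp 1) s hs')
      (cH (hw.mul (hp 1)) (hp 0) s hs') (cH (hA 0) hfst s hs') (cH (hA 1) hsnd s hs')]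
    refine setIntegral_eq_zero_of_forall_eq_zero fun y hy => ?_
    obtain ⟨e1, e2⟩ := hh s hs y hy
    simp only [cov2, Fin.sum_univ_two] at e1 e2
    simp only [pd_fst, pd_snd, fluxCoeff, if_true]
    linear_combination dens g11 g12 g22 (y, s) * (pd 0 z (y, s) * e2 - pd 1 z (y, s) * e1)
  rw [setIntegral_congr_fun measurableSet_Icc (fun x hx =>
      (flux_divergence hΩ hg hz (hsub hx) (hD x (hsub hx))).symm),
    setIntegral_sub_add_add isCompact_Icc (cI (hw.mul (hp 0)) (hp 1))
      (cI (hw.mul (hp 1)) (hp 0)) (cI (hA 0) hfst) (cI (hA 1) hsnd), g1, g2, g3, g4]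
  linear_combination V q.1 (Or.inr rfl) - V p.1 (Or.inl rfl) - H q.2 (Or.inr rfl)
    + H p.2 (Or.inl rfl)

lemma setIntegral_Icc_prod_pos {F : ℝ × ℝ → ℝ} {p q : ℝ × ℝ} (h1 : p.1 < q.1) (h2 : p.2 < q.2)
    (hF : ContinuousOn F (Icc p q)) (hnn : ∀ x ∈ Icc p q, 0 ≤ F x)
    (hpos : ∀ x ∈ Ioo p.1 q.1 ×ˢ Ioo p.2 q.2, 0 < F x) : 0 < ∫ x in Icc p q, F x := by
  rw [setIntegral_pos_iff_support_of_nonneg_ae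
    ((ae_restrict_iff' measurableSet_Icc).2 (ae_of_all _ hnn))
    (hF.integrableOn_compact isCompact_Icc)]
  have hsub : Ioo p.1 q.1 ×ˢ Ioo p.2 q.2 ⊆ Function.support F ∩ Icc p q := fun x hx =>
    ⟨(hpos x hx).ne', ⟨hx.1.1.le, hx.2.1.le⟩, ⟨hx.1.2.le, hx.2.2.le⟩⟩
  refine lt_of_lt_of_le ?_ (measure_mono hsub)
  exact ((isOpen_Ioo.prod isOpen_Ioo).measure_pos volume
    ((nonempty_Ioo.2 h1).prod (nonempty_Ioo.2 h2)))

lemma continuousOn_gradSq (hΩ : IsOpen Ω) (hg : IsMetricOn g11 g12 g22 Ω)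
    (hz : ContDiffOn ℝ 2 z Ω) : ContinuousOn (gradSq g11 g12 g22 z) Ω := by
  have hp : ∀ i, ContinuousOn (pd i z) Ω := fun i =>
    (contDiffOn_pd (m := 1) hΩ i hz (by norm_num)).continuousOn
  have hi := fun i j => (contDiffOn_ginv hg i j).continuousOn
  unfold gradSq
  exact continuousOn_finsetSum _ fun i _ => continuousOn_finsetSum _ fun j _ =>
    ((hi i j).mul (hp i)).mul (hp j)

lemma halfw_pos {n : ℕ} (hn : 1 ≤ n) : 0 < halfw n := by
  have : (0 : ℝ) < n := by exact_mod_cast hn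
  unfold halfw; positivity

lemma mem_closure_sqX {n : ℕ} (hn : 1 ≤ n) {x : ℝ × ℝ} (h1 : |x.1 - 1 / (n : ℝ)| ≤ halfw n)
    (h2 : |x.2| ≤ halfw n) : x ∈ closure (sqX n) := by
  have hh := halfw_pos hn
  have e : sqX n = Ioo (1 / (n : ℝ) - halfw n) (1 / (n : ℝ) + halfw n)
      ×ˢ Ioo (-halfw n) (halfw n) := by
    ext y
    simp only [sqX, mem_ofPred_eq, abs_lt, mem_prod, mem_Ioo]
    constructor <;> rintro ⟨⟨a, b⟩, c, d⟩ <;> refine ⟨⟨?_, ?_⟩, ?_, ?_⟩ <;> linarith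
  rw [abs_le] at h1 h2
  rw [e, closure_prod_eq, closure_Ioo (by linarith), closure_Ioo (by linarith)]
  exact ⟨⟨by linarith, by linarith⟩, h2⟩

/-- The rescaling carrying the square `Xⁿ` to `X`, in terms of the half-width. -/
lemma abs_scale {n : ℕ} (hn : 1 ≤ n) (t : ℝ) :
    |4 * (n : ℝ) * ((n : ℝ) + 1) * t| = |t| / halfw n := by
  have : (0 : ℝ) < n := by exact_mod_cast hn
  rw [abs_mul, abs_of_pos (by positivity), halfw]
  field_simp

variable {φ K : ℝ × ℝ → ℝ} {γ : ℕ → ℝ}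

lemma curvature_eq_zero_of_boundary (hφ : PhiAdmissible φ) (hK : Kconstr φ γ K) {n : ℕ}
    (hn : 1 ≤ n) {x : ℝ × ℝ} (h1 : |x.1 - 1 / (n : ℝ)| ≤ halfw n) (h2 : |x.2| ≤ halfw n)
    (hb : halfw n ≤ |x.1 - 1 / (n : ℝ)| ∨ halfw n ≤ |x.2|) : K x = 0 := by
  have hh := halfw_pos hn
  have hX : IsOpen Xset := isOpen_Ioo.prod isOpen_Ioo
  have hcl : closure Xset = Icc (-1 : ℝ) 1 ×ˢ Icc (-1 : ℝ) 1 := by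
    rw [Xset, closure_prod_eq, closure_Ioo (by norm_num)]
  rw [hK.1 n hn x (mem_closure_sqX hn h1 h2)]
  have hfr : (4 * (n : ℝ) * ((n : ℝ) + 1)) • (x - qpt n) ∈ frontier Xset := by
    rw [hX.frontier_eq, hcl]
    have e1 : ((4 * (n : ℝ) * ((n : ℝ) + 1)) • (x - qpt n)).1
      = 4 * (n : ℝ) * ((n : ℝ) + 1) * (x.1 - 1 / (n : ℝ)) := by simp [qpt]
    have e2 : ((4 * (n : ℝ) * ((n : ℝ) + 1)) • (x - qpt n)).2
      = 4 * (n : ℝ) * ((n : ℝ) + 1) * x.2 := by simp [qpt]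
    refine ⟨⟨abs_le.1 ?_, abs_le.1 ?_⟩, fun hm => ?_⟩
    · rw [e1, abs_scale hn, div_le_one hh]; exact h1
    · rw [e2, abs_scale hn, div_le_one hh]; exact h2
    · have m1 := abs_lt.2 hm.1
      have m2 := abs_lt.2 hm.2
      rw [e1, abs_scale hn, div_lt_one hh] at m1
      rw [e2, abs_scale hn, div_lt_one hh] at m2
      rcases hb with hb | hb <;> linarith
  have h0 := hφ.2.1 0 _ hfr
  have h0' := congrArg (fun m => m ![]) h0
  simp only [iteratedFDerivWithin_zero_apply] at h0'
  rw [h0']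
  simp

lemma curvature_sign (hφ : PhiAdmissible φ) (hγ : ∀ n : ℕ, 1 ≤ n → 0 < γ n)
    (hK : Kconstr φ γ K) {n : ℕ} (hn : 1 ≤ n) :
    (∀ x ∈ sqX n, 0 < K x) ∨ (∀ x ∈ sqX n, K x < 0) := by
  have hh := halfw_pos hn
  have hm : ∀ x ∈ sqX n, (4 * (n : ℝ) * ((n : ℝ) + 1)) • (x - qpt n) ∈ Xset := by
    intro x hx
    refine ⟨abs_lt.1 ?_, abs_lt.1 ?_⟩
    · have := abs_scale hn (x.1 - 1 / (n : ℝ))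
      simp only [Prod.smul_fst, Prod.fst_sub, qpt, smul_eq_mul]
      rw [this, div_lt_one hh]; exact hx.1
    · have := abs_scale hn x.2
      simp only [Prod.smul_snd, Prod.snd_sub, qpt, smul_eq_mul, sub_zero]
      rw [this, div_lt_one hh]; exact hx.2
  refine hφ.2.2.imp (fun h x hx => ?_) (fun h x hx => ?_) <;>
    rw [hK.1 n hn x (subset_closure hx)]
  · exact mul_pos (hγ n hn) (h _ (hm x hx))
  · exact mul_neg_of_pos_of_neg (hγ n hn) (h _ (hm x hx))

/-- Where the curvature vanishes, a vanishing diagonal entry of the covariant Hessian of a solution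
of Darboux's equation forces the mixed entries to vanish. -/
lemma cov2_mixed_eq_zero (hΩ : IsOpen Ω) (hz : ContDiffOn ℝ 2 z Ω) {x : ℝ × ℝ} (hx : x ∈ Ω)
    (hD : DarbouxEq g11 g12 g22 z x) (hK : GaussK g11 g12 g22 x = 0)
    (h : cov2 g11 g12 g22 z 0 0 x = 0 ∨ cov2 g11 g12 g22 z 1 1 x = 0) :
    cov2 g11 g12 g22 z 0 1 x = 0 ∧ cov2 g11 g12 g22 z 1 0 x = 0 := by
  have hsymm : cov2 g11 g12 g22 z 0 1 x = cov2 g11 g12 g22 z 1 0 x := by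
    simp only [cov2, pd_comm hΩ hz hx 0 1, Chr_comm _ 0 1]
  have h0 : cov2 g11 g12 g22 z 0 0 x * cov2 g11 g12 g22 z 1 1 x = 0 := mul_eq_zero.2 h
  unfold DarbouxEq at hD
  rw [h0, hK, ← hsymm, zero_mul, zero_mul, zero_sub, neg_eq_zero, mul_self_eq_zero] at hD
  exact ⟨hD, hsymm ▸ hD⟩

lemma exists_sqX_subset_ball {r : ℝ} (hr : 0 < r) : ∃ N : ℕ, 1 ≤ N ∧ ∀ n ≥ N,
    Icc ((1 / (n : ℝ) - halfw n, -halfw n) : ℝ × ℝ) (1 / (n : ℝ) + halfw n, halfw n)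
      ⊆ Metric.ball (0, 0) r := by
  obtain ⟨N, hN⟩ := exists_nat_gt (2 / r)
  have hN0 : (0 : ℝ) < N := (by positivity : 0 < 2 / r).trans hN
  refine ⟨N, by exact_mod_cast hN0, fun n hn x hx => ?_⟩
  have hNn : (N : ℝ) ≤ n := by exact_mod_cast hn
  have hn0 : (0 : ℝ) < n := hN0.trans_le hNn
  have h1 : 1 / (n : ℝ) < r / 2 := by
    rw [div_lt_iff₀ hr] at hN
    rw [div_lt_iff₀ hn0]
    nlinarith
  have h2 : halfw n ≤ 1 / (n : ℝ) := by
    unfold halfw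
    exact one_div_le_one_div_of_le hn0 (by nlinarith)
  obtain ⟨⟨a, b⟩, c, d⟩ := hx
  simp only at a b c d
  rw [Metric.mem_ball, Prod.dist_eq, max_lt_iff, Real.dist_eq, Real.dist_eq, sub_zero, sub_zero,
    abs_lt, abs_lt]
  refine ⟨⟨?_, ?_⟩, ?_, ?_⟩ <;> linarith

end Assembly

theorem darboux_second_cov_derivs_not_all_vanish
    (φ K : ℝ × ℝ → ℝ) (γ : ℕ → ℝ)
    (hφ : PhiAdmissible φ)
    (hγpos : ∀ n : ℕ, 1 ≤ n → 0 < γ n)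
    (hγ0 : Tendsto γ atTop (𝓝 0))
    (hKc : Kconstr φ γ K) (hKsm : ContDiff ℝ (⊤ : ℕ∞) K)
    (Ω : Set (ℝ × ℝ)) (hΩ : IsOpen Ω) (h0 : (0, 0) ∈ Ω)
    (g11 g12 g22 : ℝ × ℝ → ℝ) (hg : IsMetricOn g11 g12 g22 Ω)
    (hgK : ∀ p ∈ Ω, GaussK g11 g12 g22 p = K p)
    (z : ℝ × ℝ → ℝ)
    (hz : ContDiffOn ℝ 2 z Ω)
    (hD : ∀ p ∈ Ω, DarbouxEq g11 g12 g22 z p)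
    (hz0 : fderiv ℝ z (0, 0) = 0) :
    ∃ N : ℕ, ∀ n ≥ N,
      ¬ ((∀ p ∈ vSideL n ∪ vSideR n, cov2 g11 g12 g22 z 1 1 p = 0) ∧
         (∀ p ∈ hSideT n ∪ hSideB n, cov2 g11 g12 g22 z 0 0 p = 0)) := by
  have hgrad := continuousOn_gradSq hΩ hg hz
  have hgrad0 : gradSq g11 g12 g22 z (0, 0) = 0 := by simp [gradSq, pd, hz0]
  have hnhds : {x | x ∈ Ω ∧ gradSq g11 g12 g22 z x < 2 / 3} ∈ 𝓝 ((0, 0) : ℝ × ℝ) :=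
    Filter.inter_mem (hΩ.mem_nhds h0) ((hgrad.continuousAt (hΩ.mem_nhds h0)).eventually_lt_const
      (by rw [hgrad0]; norm_num))
  obtain ⟨R, hR, hball⟩ := Metric.nhds_basis_closedBall.mem_iff.1 hnhds
  obtain ⟨N, hN1, hN⟩ := exists_sqX_subset_ball (half_pos hR)
  refine ⟨N, fun n hn ⟨hv, hh⟩ => ?_⟩
  have hn1 : 1 ≤ n := hN1.trans hn
  have hw := halfw_pos hn1
  have hsmall := hN n hn
  have hin : ∀ x ∈ Icc ((1 / (n : ℝ) - halfw n, -halfw n) : ℝ × ℝ)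
      (1 / (n : ℝ) + halfw n, halfw n), x ∈ Ω ∧ gradSq g11 g12 g22 z x < 2 / 3 := fun x hx =>
    hball (Metric.closedBall_subset_closedBall (by linarith)
      (Metric.ball_subset_closedBall (hsmall hx)))
  have habs : ∀ x ∈ Icc ((1 / (n : ℝ) - halfw n, -halfw n) : ℝ × ℝ)
      (1 / (n : ℝ) + halfw n, halfw n), |x.1 - 1 / (n : ℝ)| ≤ halfw n ∧ |x.2| ≤ halfw n := by
    rintro x ⟨⟨a, b⟩, c, d⟩
    simp only at a b c d
    refine ⟨abs_le.2 ⟨by linarith, by linarith⟩, abs_le.2 ⟨b, d⟩⟩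
  have hzero := setIntegral_curvature_eq_zero hΩ hg hz hD hR (fun x hx => (hball hx).1)
    (p := (1 / (n : ℝ) - halfw n, -halfw n)) (q := (1 / (n : ℝ) + halfw n, halfw n))
    ⟨by simp only; linarith, by simp only; linarith⟩ hsmall
    (by
      intro s hs y hy
      have hs1 : |s - 1 / (n : ℝ)| = halfw n := by
        rcases hs with rfl | rfl <;> simp [abs_of_pos hw]
      have hm : (s, y) ∈ Icc ((1 / (n : ℝ) - halfw n, -halfw n) : ℝ × ℝ)
          (1 / (n : ℝ) + halfw n, halfw n) := by
        rcases hs with rfl | rfl <;>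
          exact ⟨⟨by simp only; linarith, hy.1⟩, by simp only; linarith, hy.2⟩
      have hK0 := curvature_eq_zero_of_boundary hφ hKc hn1 (habs _ hm).1 (habs _ hm).2
        (Or.inl hs1.ge)
      have hc : cov2 g11 g12 g22 z 1 1 (s, y) = 0 :=
        hv _ (hs.imp (fun e => ⟨e, (habs _ hm).2⟩) fun e => ⟨e, (habs _ hm).2⟩)
      exact ⟨hc, (cov2_mixed_eq_zero hΩ hz (hin _ hm).1 (hD _ (hin _ hm).1)
        ((hgK _ (hin _ hm).1).trans hK0) (Or.inr hc)).2⟩)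
    (by
      intro s hs x hx
      have hs1 : |s| = halfw n := by
        rcases hs with rfl | rfl <;> simp [abs_of_pos hw]
      have hm : (x, s) ∈ Icc ((1 / (n : ℝ) - halfw n, -halfw n) : ℝ × ℝ)
          (1 / (n : ℝ) + halfw n, halfw n) := by
        rcases hs with rfl | rfl <;>
          exact ⟨⟨hx.1, by simp only; linarith⟩, hx.2, by simp only; linarith⟩
      have hK0 := curvature_eq_zero_of_boundary hφ hKc hn1 (habs _ hm).1 (habs _ hm).2
        (Or.inr hs1.ge)
      have hc : cov2 g11 g12 g22 z 0 0 (x, s) = 0 :=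
        hh _ (hs.symm.imp (fun e => ⟨e, (habs _ hm).1⟩) fun e => ⟨e, (habs _ hm).1⟩)
      exact ⟨hc, (cov2_mixed_eq_zero hΩ hz (hin _ hm).1 (hD _ (hin _ hm).1)
        ((hgK _ (hin _ hm).1).trans hK0) (Or.inl hc)).1⟩)
  have hdens : ∀ x ∈ Ω, 0 < dens g11 g12 g22 x := fun x hx =>
    inv_pos.2 (Real.sqrt_pos.2 (hg.2.2.2 x hx).2)
  have hweight : ∀ x ∈ Icc ((1 / (n : ℝ) - halfw n, -halfw n) : ℝ × ℝ)
      (1 / (n : ℝ) + halfw n, halfw n), 0 < dens g11 g12 g22 x * gdet g11 g12 g22 x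
        * (2 - 3 * gradSq g11 g12 g22 z x) := fun x hx =>
    mul_pos (mul_pos (hdens x (hin x hx).1) (hg.2.2.2 x (hin x hx).1).2)
      (by linarith [(hin x hx).2])
  have hdet : ContinuousOn (gdet g11 g12 g22) Ω := (contDiffOn_gdet hg).continuousOn
  have hcont : ∀ σ : ℝ, ContinuousOn (fun x => dens g11 g12 g22 x * gdet g11 g12 g22 x
      * (2 - 3 * gradSq g11 g12 g22 z x) * (σ * K x))
      (Icc ((1 / (n : ℝ) - halfw n, -halfw n) : ℝ × ℝ) (1 / (n : ℝ) + halfw n, halfw n)) :=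
    fun σ => ((((contDiffOn_dens hg).continuousOn.mul hdet).mul
      (continuousOn_const.sub (continuousOn_const.mul hgrad))).mul
      (continuousOn_const.mul hKsm.continuous.continuousOn)).mono fun x hx => (hin x hx).1
  have hint : ∀ σ : ℝ, ∫ x in Icc ((1 / (n : ℝ) - halfw n, -halfw n) : ℝ × ℝ)
      (1 / (n : ℝ) + halfw n, halfw n), dens g11 g12 g22 x * gdet g11 g12 g22 x
      * (2 - 3 * gradSq g11 g12 g22 z x) * (σ * K x) = 0 := by
    intro σ
    rw [← mul_zero σ, ← hzero, ← MeasureTheory.integral_const_mul]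
    refine MeasureTheory.setIntegral_congr_fun measurableSet_Icc fun x hx => ?_
    simp only [hgK x (hin x hx).1]
    ring
  have hmain : ∀ σ : ℝ, ¬ ∀ x ∈ sqX n, 0 < σ * K x := by
    intro σ hσ
    refine (setIntegral_Icc_prod_pos (by simp only; linarith) (by simp only; linarith) (hcont σ)
      (fun x hx => mul_nonneg (hweight x hx).le ?_)
      fun x hx => mul_pos (hweight x ?_) (hσ x ?_)).ne' (hint σ)
    · by_cases hx' : x ∈ sqX n
      · exact (hσ x hx').le
      · rw [curvature_eq_zero_of_boundary hφ hKc hn1 (habs x hx).1 (habs x hx).2, mul_zero]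
        by_contra! hlt
        exact hx' hlt
    · exact ⟨⟨hx.1.1.le, hx.2.1.le⟩, hx.1.2.le, hx.2.2.le⟩
    · obtain ⟨⟨a, b⟩, c, d⟩ := hx
      exact ⟨abs_lt.2 ⟨by linarith, by linarith⟩, abs_lt.2 ⟨c, d⟩⟩
  rcases curvature_sign hφ hγpos hKc hn1 with hs | hs
  · exact hmain 1 fun x hx => by simpa using hs x hx
  · exact hmain (-1) fun x hx => by simpa using hs x hx

end
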